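/- arXiv:2402.15918 — 2 statements merged into one kernel-verified Lean document; each statement's English description precedes it below -/
import Mathlib

section
/- Let G be a finite non-trivial Cpo-group. Then every proper subgroup of G is nilpotent, and G is solvable. -/
/-- A group `G` is a Cpo-group if the centralizer of every non-trivial element
has prime order. -/
def IsCpoGroup (G : Type*) [Group G] : Prop :=
  ∀ x : G, x ≠ 1 → (Nat.card (Subgroup.centralizer ({x} : Set G))).Prime

namespace IsCpoGroup

variable {G : Type*} [Group G]

/-- A subgroup of a Cpo-group with non-trivial center has prime order. -/
theorem card_prime_of_nontrivial_center (hG : IsCpoGroup G) (H : Subgroup G)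
    [Nontrivial (Subgroup.center H)] : (Nat.card H).Prime := by
  obtain ⟨z, hz⟩ := exists_ne (1 : Subgroup.center H)
  have hz1 : ((z : H) : G) ≠ 1 := by simpa using hz
  have hle : H ≤ Subgroup.centralizer {((z : H) : G)} := fun h hh ↦ by
    rw [Subgroup.mem_centralizer_singleton_iff]
    exact congrArg Subtype.val (Subgroup.mem_center_iff.mp z.2 ⟨h, hh⟩)
  have hp := hG _ hz1
  rcases (Nat.dvd_prime hp).mp (Subgroup.card_dvd_of_le hle) with h | h
  · refine absurd ?_ hz1
    rw [Subgroup.card_eq_one] at h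
    exact (Subgroup.mem_bot).mp (h ▸ (z : H).2)
  · rwa [h]

theorem card_eq_one_or_prime_of_isCyclic (hG : IsCpoGroup G) (H : Subgroup G) [IsCyclic H] :
    Nat.card H = 1 ∨ (Nat.card H).Prime := by
  rcases subsingleton_or_nontrivial H with _ | _
  · exact .inl Nat.card_unique
  · let _ : CommGroup H := IsCyclic.commGroup
    have : Nontrivial (Subgroup.center H) := by
      rw [CommGroup.center_eq_top]
      infer_instance
    exact .inr (hG.card_prime_of_nontrivial_center H)

theorem isZGroup [Finite G] (hG : IsCpoGroup G) : IsZGroup G := by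
  refine ⟨fun p hp P ↦ ?_⟩
  have := Fact.mk hp
  rcases subsingleton_or_nontrivial P with _ | _
  · infer_instance
  · have := P.2.center_nontrivial
    have := Fact.mk (hG.card_prime_of_nontrivial_center P.1)
    exact isCyclic_of_prime_card (p := Nat.card P) rfl

end IsCpoGroup

theorem Nat.eq_one_or_prime_of_mul_eq_mul {a b c d : ℕ} (ha : a = 1 ∨ a.Prime)
    (hb : b = 1 ∨ b.Prime) (h : c * d = a * b) (hd : d ≠ 1) : c = 1 ∨ c.Prime := by
  rcases ha with rfl | ha
  · rcases hb with rfl | hb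
    · exact .inl (Nat.eq_one_of_mul_eq_one_right h)
    · exact ((Nat.dvd_prime hb).mp ⟨d, by lia⟩).imp_right (fun hc ↦ by rwa [hc])
  · rcases hb with rfl | hb
    · exact ((Nat.dvd_prime ha).mp ⟨d, by lia⟩).imp_right (fun hc ↦ by rwa [hc])
    · rcases (Nat.dvd_mul.mp ⟨d, h.symm⟩) with ⟨x, y, hx, hy, rfl⟩
      rcases (Nat.dvd_prime ha).mp hx with rfl | rfl <;>
        rcases (Nat.dvd_prime hb).mp hy with rfl | rfl
      · simp
      · simp [hb]
      · simp [ha]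
      · exact absurd (Nat.eq_of_mul_eq_mul_left (Nat.mul_pos ha.pos hb.pos)
          (h.trans (mul_one _).symm)) hd

theorem stmt_6 (G : Type*) [Group G] [Finite G] (hG : IsCpoGroup G)
    (hnt : Nat.card G ≠ 1) :
    (∀ H : Subgroup G, H ≠ ⊤ → Group.IsNilpotent H) ∧ IsSolvable G := by
  have hZ := hG.isZGroup
  refine ⟨fun K hK ↦ ?_, inferInstanceAs (Group.IsSolvable G)⟩
  obtain ⟨N, H, φ, e, _, _, -⟩ := isZGroup_iff_exists_mulEquiv.mp hZ
  have hcard : Nat.card K * K.index = Nat.card N * Nat.card H := by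
    rw [K.card_mul_index, Nat.card_congr e.toEquiv, SemidirectProduct.card]
  rcases Nat.eq_one_or_prime_of_mul_eq_mul (hG.card_eq_one_or_prime_of_isCyclic N)
    (hG.card_eq_one_or_prime_of_isCyclic H) hcard (by simpa using hK) with h | h
  · have := (Nat.card_eq_one_iff_unique.mp h).1
    infer_instance
  · have := Fact.mk h
    exact (IsPGroup.of_card (p := Nat.card K) (n := 1) (by simp)).isNilpotent
end

section
/- Let G be a finite non-abelian Cpo-group. Then there exists a prime p dividing |G|, a normal Sylow p-subgroup P of G with |P| = p, and an abelian subgroup H of G whose order is coprime to p, such that P ∩ H = 1, G = PH, and for every non-trivial h ∈ H and every non-trivial x ∈ P, h and x do not commute (so G is a Frobenius group with kernel P and complement H). -/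
namespace IsCpoGroup

variable {G : Type*} [Group G]

/-- In a Cpo-group, a subgroup with a non-trivial central element `x` is the centralizer of `x`. -/
theorem eq_centralizer (hG : IsCpoGroup G) {K : Subgroup G} {x : G} (hx : x ≠ 1) (hxK : x ∈ K)
    (hK : K ≤ Subgroup.centralizer {x}) : K = Subgroup.centralizer {x} := by
  have hp := hG x hx
  have : Finite (Subgroup.centralizer {x}) := Nat.finite_of_card_ne_zero hp.ne_zero
  have hcard : Nat.card K = Nat.card (Subgroup.centralizer {x}) := by
    refine (hp.eq_one_or_self_of_dvd _ (Subgroup.card_dvd_of_le hK)).resolve_left fun h ↦ hx ?_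
    rwa [Subgroup.card_eq_one.mp h, Subgroup.mem_bot] at hxK
  exact Subgroup.eq_of_le_of_card_ge hK hcard.ge

/-- In a Cpo-group, every subgroup with a non-trivial center has prime order. -/
theorem prime_card_of_nontrivial_center (hG : IsCpoGroup G) (K : Subgroup G)
    [Nontrivial (Subgroup.center K)] : (Nat.card K).Prime := by
  obtain ⟨⟨⟨x, hxK⟩, hxc⟩, hx⟩ := exists_ne (1 : Subgroup.center K)
  have hx1 : x ≠ 1 := fun h ↦ hx (by ext; exact h)
  rw [hG.eq_centralizer hx1 hxK fun k hk ↦ ?_]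
  · exact hG x hx1
  · exact Subgroup.mem_centralizer_singleton_iff.mpr
      (congrArg Subtype.val (Subgroup.mem_center_iff.mp hxc ⟨k, hk⟩))

/-- In a finite non-abelian Cpo-group, the commutator subgroup has prime order. -/
theorem prime_card_commutator [Finite G] (hG : IsCpoGroup G)
    (hna : ¬ ∀ a b : G, a * b = b * a) : (Nat.card (commutator G)).Prime := by
  have := hG.isZGroup
  have hcyc : IsCyclic (commutator G) := IsZGroup.isCyclic_commutator G
  have : Nontrivial (commutator G) := by
    rw [Subgroup.nontrivial_iff_ne_bot]
    refine fun h ↦ hna fun a b ↦ commutatorElement_eq_one_iff_mul_comm.mp ?_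
    rw [← Subgroup.mem_bot, ← h]
    exact Subgroup.commutator_mem_commutator (Subgroup.mem_top a) (Subgroup.mem_top b)
  let := hcyc.commGroup
  have : Nontrivial (Subgroup.center (commutator G)) := by
    obtain ⟨x, hx⟩ := exists_ne (1 : commutator G)
    exact ⟨⟨x, Subgroup.mem_center_iff.mpr fun g ↦ mul_comm g x⟩, 1, fun h ↦
      hx (congrArg Subtype.val h)⟩
  exact hG.prime_card_of_nontrivial_center _

end IsCpoGroup

theorem stmt_12 (G : Type*) [Group G] [Finite G] (hG : IsCpoGroup G)
    (hna : ¬ ∀ a b : G, a * b = b * a) :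
    ∃ p : ℕ, p.Prime ∧ p ∣ Nat.card G ∧
      ∃ P : Sylow p G, (P : Subgroup G).Normal ∧ Nat.card (P : Subgroup G) = p ∧
        ∃ H : Subgroup G, (∀ a b : H, a * b = b * a) ∧
          Nat.Coprime (Nat.card H) p ∧
          (P : Subgroup G) ⊓ H = ⊥ ∧
          (∀ g : G, ∃ x ∈ (P : Subgroup G), ∃ h ∈ H, g = x * h) ∧
          (∀ h ∈ H, h ≠ 1 → ∀ x ∈ (P : Subgroup G), x ≠ 1 → h * x ≠ x * h) := by
  have := hG.isZGroup
  have hp := hG.prime_card_commutator hna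
  have := Fact.mk hp
  have hcop : (Nat.card (commutator G)).Coprime (commutator G).index :=
    IsZGroup.coprime_commutator_index G
  obtain ⟨H, hH⟩ := Subgroup.exists_right_complement'_of_coprime hcop
  have hdisj : commutator G ⊓ H = ⊥ := hH.disjoint.eq_bot
  have hP : IsPGroup (Nat.card (commutator G)) (commutator G) :=
    IsPGroup.of_card (n := 1) (pow_one _).symm
  refine ⟨_, hp, Subgroup.card_subgroup_dvd_card _,
    hP.toSylow (hp.coprime_iff_not_dvd.mp hcop), ?_, rfl, H, ?_, ?_, hdisj, ?_, ?_⟩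
  · exact inferInstanceAs (commutator G).Normal
  · refine fun a b ↦ Subtype.ext (commutatorElement_eq_one_iff_mul_comm.mp ?_)
    rw [← Subgroup.mem_bot, ← hdisj]
    exact ⟨Subgroup.commutator_mem_commutator (Subgroup.mem_top _) (Subgroup.mem_top _),
      H.mul_mem (H.mul_mem (H.mul_mem a.2 b.2) (H.inv_mem a.2)) (H.inv_mem b.2)⟩
  · rw [← hH.symm.index_eq_card]
    exact hcop.symm
  · intro g
    obtain ⟨⟨x, h⟩, rfl⟩ := hH.2 g
    exact ⟨x, x.2, h, h.2, rfl⟩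
  · intro h hhH hh x hx hx1 hcomm
    have hcyc : IsCyclic (commutator G) := IsZGroup.isCyclic_commutator G
    let := hcyc.commGroup
    replace hx : x ∈ commutator G := hx
    have hC : commutator G = Subgroup.centralizer {x} := hG.eq_centralizer hx1 hx fun k hk ↦
      Subgroup.mem_centralizer_singleton_iff.mpr
        (congrArg Subtype.val (mul_comm (⟨k, hk⟩ : commutator G) ⟨x, hx⟩))
    have hmem : h ∈ commutator G ⊓ H :=
      ⟨hC ▸ Subgroup.mem_centralizer_singleton_iff.mpr hcomm, hhH⟩
    rw [hdisj, Subgroup.mem_bot] at hmem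
    exact hh hmem
end
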